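/- For all real α with α ≤ 1/9 and α ≠ 0, and all θ ∈ (0, π), the quantity Δ(θ) := 16α²cos⁴θ − 8α²cos²θ − 8αcos²θ + α² − 2α + 1 is strictly positive. -/

import Mathlib

theorem stmt0 (α : ℝ) (hα : α ≤ 1/9) (hα0 : α ≠ 0) (θ : ℝ) (hθ : θ ∈ Set.Ioo 0 Real.pi) :
    0 < 16*α^2*(Real.cos θ)^4 - 8*α^2*(Real.cos θ)^2 - 8*α*(Real.cos θ)^2 + α^2 - 2*α + 1 := by
  have hs : 0 < Real.sin θ := Real.sin_pos_of_pos_of_lt_pi hθ.1 hθ.2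
  have hc : (Real.cos θ)^2 < 1 := by
    have h1 := Real.sin_sq_add_cos_sq θ
    have h2 : 0 < (Real.sin θ)^2 := by positivity
    linarith
  have key : 16*α^2*(Real.cos θ)^4 - 8*α^2*(Real.cos θ)^2 - 8*α*(Real.cos θ)^2 + α^2 - 2*α + 1
      = (1 + α - 4*α*(Real.cos θ)^2)^2 - 4*α := by ring
  rw [key]
  rcases lt_or_gt_of_ne hα0 with h | h
  · have := sq_nonneg (1 + α - 4*α*(Real.cos θ)^2)
    linarith
  · have h3 : 1 - 3*α < 1 + α - 4*α*(Real.cos θ)^2 := by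
      have := mul_lt_mul_of_pos_left hc h
      linarith
    have h4 : (1 - 3*α)^2 < (1 + α - 4*α*(Real.cos θ)^2)^2 :=
      pow_lt_pow_left₀ h3 (by linarith) (by norm_num)
    have h5 : 0 ≤ (1 - α) * (1 - 9*α) := mul_nonneg (by linarith) (by linarith)
    nlinarith
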